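/- Fix a positive integer d and a tuple of non-negative integers w = (w_0, …, w_{d-1}) with w_{d-1} ≥ 1; let W = max{w_0, …, w_{d-1}} and let c = c_w be the unique positive real root of P_w. Let {a_n}_{n=1}^∞ be a monotonically increasing sequence of positive integers, and define μ_n = (log a_n)/c^n, δ_n = 1/n², and, for n ≥ d, x_n = a_{n-d+1}^{w_0} a_{n-d+2}^{w_1} ⋯ a_n^{w_{d-1}}. Suppose P and Q are positive integers with Q ≥ P + d − 2 and μ_{Q+1} > (1 + δ_Q) · max_{P ≤ k ≤ Q} μ_k. Then (a_P · a_{P+1} · ⋯ · a_Q)^W / x_{Q+1} ≤ a_{Q+1}^{-1/(Q² + 1)}. -/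

import Mathlib

open Filter Topology

/-- A weighted sum over the final window of an interval is at most the largest weight times the sum
over the whole interval, for non-negative terms. -/
theorem sum_window_le_sup_mul_sum (w : ℕ → ℕ) (e P s : ℕ) (hPs : P ≤ s) (D : ℕ → ℝ)
    (hD : ∀ k, P ≤ k → k < s + e → 0 ≤ D k) :
    ∑ j ∈ Finset.range e, (w j : ℝ) * D (s + j) ≤
      (((Finset.range (e + 1)).sup w : ℕ) : ℝ) * ∑ k ∈ Finset.Ico P (s + e), D k := by
  have hwindow : ∑ j ∈ Finset.range e, D (s + j) ≤ ∑ k ∈ Finset.Ico P (s + e), D k := by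
    have h := Finset.sum_Ico_eq_sum_range D s (s + e)
    rw [Nat.add_sub_cancel_left] at h
    rw [← h]
    refine Finset.sum_le_sum_of_subset_of_nonneg (Finset.Ico_subset_Ico_left hPs) ?_
    intro k hk _
    rw [Finset.mem_Ico] at hk
    exact hD k hk.1 hk.2
  refine le_trans ?_ (mul_le_mul_of_nonneg_left hwindow (Nat.cast_nonneg _))
  rw [Finset.mul_sum]
  refine Finset.sum_le_sum fun j hj => ?_
  rw [Finset.mem_range] at hj
  have hwj : w j ≤ (Finset.range (e + 1)).sup w :=
    Finset.le_sup (f := w) (Finset.mem_range.2 (by omega))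
  exact mul_le_mul_of_nonneg_right (by exact_mod_cast hwj) (hD _ (by omega) (by omega))

/-- If `(c - 1) ∑ w_j c^j = W c^e` with `W = max w_j` and `w_e ≥ 1`, then `1 < c`. -/
theorem one_lt_of_root (e : ℕ) (w : ℕ → ℕ) (hw : 1 ≤ w e) (c : ℝ) (hc : 0 < c)
    (hroot : (c - 1) * ∑ j ∈ Finset.range (e + 1), (w j : ℝ) * c ^ j
      = (((Finset.range (e + 1)).sup w : ℕ) : ℝ) * c ^ e) : 1 < c := by
  have hW : 1 ≤ (Finset.range (e + 1)).sup w :=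
    hw.trans (Finset.le_sup (f := w) (Finset.self_mem_range_succ e))
  have hpos : 0 < (c - 1) * ∑ j ∈ Finset.range (e + 1), (w j : ℝ) * c ^ j := by
    rw [hroot]
    have : (0 : ℝ) < (((Finset.range (e + 1)).sup w : ℕ) : ℝ) := by exact_mod_cast hW
    positivity
  have hS : 0 ≤ ∑ j ∈ Finset.range (e + 1), (w j : ℝ) * c ^ j :=
    Finset.sum_nonneg fun j _ => by positivity
  linarith [pos_of_mul_pos_left hpos hS]

/-- The largest weight times a geometric sum is at most the weighted sum over the final window,
shifted one step to the right, when `c` is a root of the associated polynomial. -/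
theorem sup_mul_geom_sum_le_window (e : ℕ) (w : ℕ → ℕ) (hw : 1 ≤ w e) (c : ℝ) (hc : 0 < c)
    (hroot : (c - 1) * ∑ j ∈ Finset.range (e + 1), (w j : ℝ) * c ^ j
      = (((Finset.range (e + 1)).sup w : ℕ) : ℝ) * c ^ e)
    (P s : ℕ) (hPs : P ≤ s) :
    (((Finset.range (e + 1)).sup w : ℕ) : ℝ) * ∑ k ∈ Finset.Ico P (s + e), c ^ k ≤
      ∑ j ∈ Finset.range (e + 1), (w j : ℝ) * c ^ (s + j) := by
  have hc1 : 0 < c - 1 := sub_pos.2 (one_lt_of_root e w hw c hc hroot)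
  have hgeom := geom_sum_Ico_mul c (show P ≤ s + e by omega)
  have hshift : ∑ j ∈ Finset.range (e + 1), (w j : ℝ) * c ^ (s + j)
      = c ^ s * ∑ j ∈ Finset.range (e + 1), (w j : ℝ) * c ^ j := by
    rw [Finset.mul_sum]
    exact Finset.sum_congr rfl fun j _ => by ring
  rw [hshift]
  refine le_of_mul_le_mul_right ?_ hc1
  rw [mul_assoc, hgeom, mul_assoc, mul_comm _ (c - 1), hroot, pow_add]
  have : 0 ≤ (((Finset.range (e + 1)).sup w : ℕ) : ℝ) * c ^ P := by positivity
  linarith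

/-- The local-peak inequality in additive form, for `L` playing the role of `log a`. -/
theorem local_peak_additive (e : ℕ) (w : ℕ → ℕ) (hw : 1 ≤ w e) (c : ℝ) (hc : 0 < c)
    (hroot : (c - 1) * ∑ j ∈ Finset.range (e + 1), (w j : ℝ) * c ^ j
      = (((Finset.range (e + 1)).sup w : ℕ) : ℝ) * c ^ e)
    (P s : ℕ) (hPs : P ≤ s) (L : ℕ → ℝ) (M t : ℝ) (hM : 0 ≤ M) (ht : 0 ≤ t) (ht1 : t ≤ 1)
    (hlast : L (s + e) = M * c ^ (s + e))
    (hL : ∀ k, P ≤ k → k < s + e → L k ≤ t * M * c ^ k) :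
    (((Finset.range (e + 1)).sup w : ℕ) : ℝ) * ∑ k ∈ Finset.Ico P (s + e), L k
      - ∑ j ∈ Finset.range (e + 1), (w j : ℝ) * L (s + j) ≤ -((1 - t) * L (s + e)) := by
  have hwindow := sum_window_le_sup_mul_sum w e P s hPs (fun k => t * M * c ^ k - L k)
    fun k h h' => sub_nonneg.2 (hL k h h')
  have hgeom := mul_le_mul_of_nonneg_left
    (sup_mul_geom_sum_le_window e w hw c hc hroot P s hPs) (mul_nonneg ht hM)
  have hwe : (1 - t) * L (s + e) ≤ (w e : ℝ) * ((1 - t) * L (s + e)) := by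
    refine le_mul_of_one_le_left ?_ (by exact_mod_cast hw)
    rw [hlast]
    exact mul_nonneg (sub_nonneg.2 ht1) (by positivity)
  have hsplit : ∑ j ∈ Finset.range e, (w j : ℝ) * (t * M * c ^ (s + j) - L (s + j))
      = t * M * ∑ j ∈ Finset.range e, (w j : ℝ) * c ^ (s + j)
        - ∑ j ∈ Finset.range e, (w j : ℝ) * L (s + j) := by
    rw [Finset.mul_sum, ← Finset.sum_sub_distrib]
    exact Finset.sum_congr rfl fun j _ => by ring
  rw [hsplit, Finset.sum_sub_distrib, ← Finset.mul_sum] at hwindow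
  rw [Finset.sum_range_succ] at hgeom ⊢
  have hcw : t * M * ((w e : ℝ) * c ^ (s + e)) = (w e : ℝ) * (t * L (s + e)) := by
    rw [hlast]
    ring
  linarith

/-- **local-peak lemma.** With `d ≥ 1`, a tuple `w` with `w (d-1) ≥ 1`,
`W = max {w 0, …, w (d-1)}`, `c` the unique positive root of `P_w`, and a non-decreasing
sequence of positive integers `a`, set `μ_n = (log a_n)/c^n`, `δ_n = 1/n²` and
`x_n = a_{n-d+1}^{w_0}⋯a_n^{w_{d-1}}` for `n ≥ d`. If `P, Q ≥ 1` satisfy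
`Q ≥ P + d − 2` and `μ_{Q+1} > (1+δ_Q)·max_{P ≤ k ≤ Q} μ_k`, then
`(a_P a_{P+1}⋯a_Q)^W / x_{Q+1} ≤ a_{Q+1}^(−1/(Q²+1))`. -/
theorem stmt_12 (d : ℕ) (hd : 0 < d) (w : ℕ → ℕ) (hw : 1 ≤ w (d - 1))
    (c : ℝ) (hc : 0 < c)
    (hroot : (c - 1) * ∑ j ∈ Finset.range d, (w j : ℝ) * c ^ j
        - (((Finset.range d).sup w : ℕ) : ℝ) * c ^ (d - 1) = 0)
    (a : ℕ → ℕ) (ha_pos : ∀ n, 1 ≤ n → 0 < a n)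
    (ha_mono : ∀ n, 1 ≤ n → a n ≤ a (n + 1))
    (P Q : ℕ) (hP : 1 ≤ P) (hPQ : P + d - 2 ≤ Q)
    (hpeak : ∀ k, P ≤ k → k ≤ Q →
      (1 + 1 / (Q : ℝ) ^ 2) * (Real.log (a k) / c ^ k)
        < Real.log (a (Q + 1)) / c ^ (Q + 1)) :
    (∏ k ∈ Finset.Icc P Q, (a k : ℝ)) ^ ((Finset.range d).sup w) /
        ∏ j ∈ Finset.range d, (a (Q + 1 - d + 1 + j) : ℝ) ^ w j
      ≤ (a (Q + 1) : ℝ) ^ (-(1 / ((Q : ℝ) ^ 2 + 1))) := by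
  obtain ⟨e, rfl⟩ : ∃ e, d = e + 1 := ⟨d - 1, by omega⟩
  obtain ⟨s, hs⟩ : ∃ s, s + e = Q + 1 := ⟨Q + 1 - e, by omega⟩
  have hPs : P ≤ s := by omega
  have hwin : Q + 1 - (e + 1) + 1 = s := by omega
  have hIcc : Finset.Icc P Q = Finset.Ico P (s + e) := by
    ext k
    simp only [Finset.mem_Icc, Finset.mem_Ico]
    omega
  rw [Nat.add_sub_cancel] at hw hroot
  have ha : ∀ k, P ≤ k → (0 : ℝ) < a k := fun k hk => by exact_mod_cast ha_pos k (hP.trans hk)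
  have haQ := ha (Q + 1) (by omega)
  have hM : 0 ≤ Real.log (a (Q + 1)) / c ^ (Q + 1) :=
    div_nonneg (Real.log_natCast_nonneg _) (by positivity)
  have hadd := local_peak_additive e w hw c hc (sub_eq_zero.1 hroot) P s hPs
    (fun k => Real.log (a k)) (Real.log (a (Q + 1)) / c ^ (Q + 1))
    ((Q : ℝ) ^ 2 / ((Q : ℝ) ^ 2 + 1)) hM (by positivity)
    (div_le_one_of_le₀ (by linarith) (by positivity))
    (by rw [hs]; exact (div_mul_cancel₀ _ (by positivity)).symm)
    (fun k hk hk' => by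
      have hQ : (0 : ℝ) < Q := by exact_mod_cast (show 0 < Q by omega)
      have h := (hpeak k hk (by omega)).le
      rw [← div_le_iff₀ (by positivity)]
      calc Real.log (a k) / c ^ k
          = (Q : ℝ) ^ 2 / ((Q : ℝ) ^ 2 + 1) *
              ((1 + 1 / (Q : ℝ) ^ 2) * (Real.log (a k) / c ^ k)) := by field_simp
        _ ≤ _ := mul_le_mul_of_nonneg_left h (by positivity))
  have hexp : 1 - (Q : ℝ) ^ 2 / ((Q : ℝ) ^ 2 + 1) = 1 / ((Q : ℝ) ^ 2 + 1) := by
    field_simp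
    ring
  have hnum : 0 < ∏ k ∈ Finset.Ico P (s + e), (a k : ℝ) :=
    Finset.prod_pos fun k hk => ha k (Finset.mem_Ico.1 hk).1
  have hfactor : ∀ j ∈ Finset.range (e + 1), 0 < (a (s + j) : ℝ) ^ w j :=
    fun j _ => pow_pos (ha _ (by omega)) _
  have hden := Finset.prod_pos hfactor
  rw [hwin, hIcc, ← Real.log_le_log_iff (by positivity) (by positivity), Real.log_rpow haQ,
    Real.log_div (by positivity) hden.ne', Real.log_pow,
    Real.log_prod fun k hk => (ha k (Finset.mem_Ico.1 hk).1).ne',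
    Real.log_prod fun j hj => (hfactor j hj).ne']
  simp only [Real.log_pow]
  rw [hexp, hs] at hadd
  rw [hs]
  linarith
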